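/- Let n = 2 and V := ℝ³ ⊗_ℝ ℝ⁴, on which a matrix g ∈ O(1,2) acts by g ⊗ id. Then there exists a nonzero antisymmetric ℝ-bilinear map β : V × V → V which is SO⁰(1,2)-equivariant, i.e. β((g⊗id)x, (g⊗id)y) = (g⊗id)β(x,y) for all g ∈ SO⁰(1,2) and all x, y ∈ V. (Thus the vanishing result for equivariant bilinear maps, valid for n ≥ 3, fails for n = 2.) -/

import Mathlib

open scoped TensorProduct Matrix

/-- The Minkowski form matrix `η = diag(−1,1,1)` of signature `(1,2)`. -/
def lorentzEta : Matrix (Fin 3) (Fin 3) ℝ :=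
  Matrix.diagonal (fun i => if i = 0 then (-1 : ℝ) else 1)

/-- The indefinite orthogonal group `O(1,2)`, as a set of matrices. -/
def lorentzO : Set (Matrix (Fin 3) (Fin 3) ℝ) :=
  {g | gᵀ * lorentzEta * g = lorentzEta}

/-- `SO⁰(1,2)`: the connected component of the identity in `O(1,2)`. -/
def lorentzSO0 : Set (Matrix (Fin 3) (Fin 3) ℝ) :=
  connectedComponentIn lorentzO 1

/-- The action of a matrix `g` on `V = ℝ³ ⊗ ℝ⁴` by `g ⊗ id`. -/
noncomputable def actV (g : Matrix (Fin 3) (Fin 3) ℝ) :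
    ((Fin 3 → ℝ) ⊗[ℝ] (Fin 4 → ℝ)) →ₗ[ℝ] ((Fin 3 → ℝ) ⊗[ℝ] (Fin 4 → ℝ)) :=
  LinearMap.rTensor (Fin 4 → ℝ) (Matrix.toLin' g)

/-- The cofactor identity for the cross product: `gᵀ (g u × g v) = det g • (u × v)`. -/
theorem transpose_mulVec_crossProduct_mulVec {R : Type*} [CommRing R]
    (g : Matrix (Fin 3) (Fin 3) R) (u v : Fin 3 → R) :
    gᵀ *ᵥ (crossProduct (g *ᵥ u) (g *ᵥ v)) = g.det • crossProduct u v := by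
  ext i
  fin_cases i <;>
    simp [cross_apply, Matrix.mulVec, dotProduct, Fin.sum_univ_three, Matrix.det_fin_three] <;>
    ring

theorem lorentzEta_mul_self : lorentzEta * lorentzEta = 1 := by
  rw [lorentzEta, Matrix.diagonal_mul_diagonal, ← Matrix.diagonal_one]
  congr 1
  ext i
  split_ifs <;> norm_num

theorem mul_lorentzEta_mul_transpose {g : Matrix (Fin 3) (Fin 3) ℝ} (hg : g ∈ lorentzO) :
    g * lorentzEta * gᵀ = lorentzEta := by
  have hg' : gᵀ * lorentzEta * g = lorentzEta := hg
  have h : lorentzEta * gᵀ * lorentzEta * g = 1 := by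
    rw [Matrix.mul_assoc, Matrix.mul_assoc, ← Matrix.mul_assoc gᵀ, hg', lorentzEta_mul_self]
  calc g * lorentzEta * gᵀ
      = g * (lorentzEta * gᵀ * lorentzEta) * lorentzEta := by
        simp only [Matrix.mul_assoc, lorentzEta_mul_self, Matrix.mul_one]
    _ = lorentzEta := by rw [mul_eq_one_comm.mp h, Matrix.one_mul]

theorem det_sq_of_mem_lorentzO {g : Matrix (Fin 3) (Fin 3) ℝ} (hg : g ∈ lorentzO) :
    g.det ^ 2 = 1 := by
  have hg' : gᵀ * lorentzEta * g = lorentzEta := hg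
  have h := congrArg Matrix.det hg'
  have hη := congrArg Matrix.det lorentzEta_mul_self
  simp only [Matrix.det_mul, Matrix.det_transpose, Matrix.det_one] at h hη
  linear_combination lorentzEta.det * h + (1 - g.det ^ 2) * hη

theorem one_mem_lorentzO : (1 : Matrix (Fin 3) (Fin 3) ℝ) ∈ lorentzO := by
  simp [lorentzO]

theorem det_eq_one_of_mem_lorentzSO0 {g : Matrix (Fin 3) (Fin 3) ℝ} (hg : g ∈ lorentzSO0) :
    g.det = 1 := by
  have h : Set.EqOn (fun g : Matrix (Fin 3) (Fin 3) ℝ => g.det) (fun _ => 1) lorentzSO0 := by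
    refine isPreconnected_connectedComponentIn.eq_of_sq_eq
      continuous_id.matrix_det.continuousOn continuousOn_const (fun x hx => ?_)
      (fun _ => one_ne_zero) (mem_connectedComponentIn one_mem_lorentzO) Matrix.det_one
    simpa using det_sq_of_mem_lorentzO (connectedComponentIn_subset _ _ hx)
  exact h hg

/-- The Lorentzian cross product `η (u × v)` on `ℝ³`. -/
noncomputable def lorentzCross : (Fin 3 → ℝ) →ₗ[ℝ] (Fin 3 → ℝ) →ₗ[ℝ] (Fin 3 → ℝ) :=
  crossProduct.compr₂ (Matrix.toLin' lorentzEta)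

theorem lorentzCross_apply (u v : Fin 3 → ℝ) :
    lorentzCross u v = lorentzEta *ᵥ crossProduct u v := by
  simp [lorentzCross]

theorem lorentzCross_anticomm (u v : Fin 3 → ℝ) : lorentzCross u v = -lorentzCross v u := by
  rw [lorentzCross_apply, lorentzCross_apply, ← cross_anticomm, Matrix.mulVec_neg]

theorem lorentzCross_mulVec {g : Matrix (Fin 3) (Fin 3) ℝ} (hg : g ∈ lorentzSO0)
    (u v : Fin 3 → ℝ) : lorentzCross (g *ᵥ u) (g *ᵥ v) = g *ᵥ lorentzCross u v := by
  have h := transpose_mulVec_crossProduct_mulVec g u v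
  rw [det_eq_one_of_mem_lorentzSO0 hg, one_smul] at h
  rw [lorentzCross_apply, lorentzCross_apply, ← h, Matrix.mulVec_mulVec, Matrix.mulVec_mulVec,
    mul_lorentzEta_mul_transpose (connectedComponentIn_subset _ _ hg)]

/-- For `n = 2` there exists a nonzero antisymmetric bilinear map
`β : V × V → V` on `V = ℝ³ ⊗ ℝ⁴` which is `SO⁰(1,2)`-equivariant. (So the vanishing
result, valid for `n ≥ 3`, fails for `n = 2`.) -/
theorem exists_nonzero_equivariant_bilinear :
    ∃ β : ((Fin 3 → ℝ) ⊗[ℝ] (Fin 4 → ℝ)) →ₗ[ℝ]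
      ((Fin 3 → ℝ) ⊗[ℝ] (Fin 4 → ℝ)) →ₗ[ℝ] ((Fin 3 → ℝ) ⊗[ℝ] (Fin 4 → ℝ)),
      β ≠ 0 ∧
      (∀ x y, β x y = - β y x) ∧
      (∀ g ∈ lorentzSO0, ∀ x y, β (actV g x) (actV g y) = actV g (β x y)) := by
  refine ⟨TensorProduct.map₂ lorentzCross (LinearMap.mul ℝ (Fin 4 → ℝ)), fun h => ?_,
    fun x y => ?_, fun g hg x y => ?_⟩
  · have h₁ := LinearMap.congr_fun₂ h (![1, 0, 0] ⊗ₜ 1) (![0, 1, 0] ⊗ₜ 1)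
    have h₂ := congrArg ((TensorProduct.lid ℝ ℝ).toLinearMap ∘ₗ
      TensorProduct.map (LinearMap.proj 2) (LinearMap.proj 0)) h₁
    simp [lorentzCross_apply, cross_apply, lorentzEta, Matrix.mulVec_diagonal] at h₂
  · induction x with
    | zero => simp
    | add x₁ x₂ h₁ h₂ => simp only [map_add, LinearMap.add_apply, h₁, h₂, neg_add]
    | tmul u a =>
      induction y with
      | zero => simp
      | add y₁ y₂ h₁ h₂ => simp only [map_add, LinearMap.add_apply, h₁, h₂, neg_add]
      | tmul v b =>
        rw [TensorProduct.map₂_apply_tmul, TensorProduct.map₂_apply_tmul, TensorProduct.map_tmul,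
          TensorProduct.map_tmul, lorentzCross_anticomm,
          TensorProduct.neg_tmul, LinearMap.mul_apply', LinearMap.mul_apply',
          mul_comm]
  · induction x with
    | zero => simp
    | add x₁ x₂ h₁ h₂ => simp only [map_add, LinearMap.add_apply, h₁, h₂]
    | tmul u a =>
      induction y with
      | zero => simp
      | add y₁ y₂ h₁ h₂ => simp only [map_add, h₁, h₂]
      | tmul v b => simp [actV, lorentzCross_mulVec hg]
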